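/- Let n ≥ 2. (1) The centre K∂_n is the least nonzero ideal of the Lie algebra u_n: every nonzero ideal of u_n contains K∂_n. (2) An ideal I of u_n is nonzero and finite-dimensional over K if and only if I = ⊕_{i=0}^{s-1} K x_1^i ∂_n for some integer s ≥ 1; in that case dim_K(I) = s. -/

import Mathlib

open MvPolynomial

noncomputable section


/-- If a derivation of `MvPolynomial σ K` maps every generator `X j`, `j ∈ s`, into the
subalgebra `supported K s` of polynomials supported on `s`, then it maps the whole of
`supported K s` into itself. -/
theorem Derivation.mem_supported_of_forall_mem
    {K : Type*} [CommRing K] {σ : Type*} (s : Set σ)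
    (D : Derivation K (MvPolynomial σ K) (MvPolynomial σ K))
    (h : ∀ j ∈ s, D (X j) ∈ supported K s)
    {p : MvPolynomial σ K} (hp : p ∈ supported K s) : D p ∈ supported K s := by
  rw [supported_eq_adjoin_X] at hp
  induction hp using Algebra.adjoin_induction with
  | mem x hx =>
    obtain ⟨j, hj, rfl⟩ := hx
    exact h j hj
  | algebraMap r =>
    rw [Derivation.map_algebraMap]
    exact zero_mem _
  | add x y hx hy ihx ihy =>
    rw [map_add]
    exact add_mem ihx ihy
  | mul x y hx hy ihx ihy =>
    rw [Derivation.leibniz, smul_eq_mul, smul_eq_mul]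
    rw [← supported_eq_adjoin_X] at hx hy
    exact add_mem (mul_mem hx ihy) (mul_mem hy ihx)

/-- If a derivation of `MvPolynomial σ K` kills every generator `X j`, `j ∈ s`, then it
kills the whole subalgebra `supported K s`. -/
theorem Derivation.eq_zero_of_forall_eq_zero
    {K : Type*} [CommRing K] {σ : Type*} (s : Set σ)
    (D : Derivation K (MvPolynomial σ K) (MvPolynomial σ K))
    (h : ∀ j ∈ s, D (X j) = 0)
    {p : MvPolynomial σ K} (hp : p ∈ supported K s) : D p = 0 := by
  rw [supported_eq_adjoin_X] at hp
  induction hp using Algebra.adjoin_induction with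
  | mem x hx =>
    obtain ⟨j, hj, rfl⟩ := hx
    exact h j hj
  | algebraMap r =>
    rw [Derivation.map_algebraMap]
  | add x y hx hy ihx ihy =>
    rw [map_add, ihx, ihy, add_zero]
  | mul x y hx hy ihx ihy =>
    rw [Derivation.leibniz, ihx, ihy, smul_zero, smul_zero, add_zero]

/-- The defining condition for the Lie algebra `u_n = K∂₁ ⊕ P₁∂₂ ⊕ ⋯ ⊕ P_{n-1}∂ₙ` of
triangular polynomial derivations of `P_n = K[x₁,…,xₙ]` (variables indexed by `Fin n`,
zero-based): a derivation `D` of `P_n` is triangular iff, for every `i`, the polynomial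
`D (X i)` only involves the variables `X j` with `j < i` (so the coefficient of `∂_i`
lies in `P_{i-1}`, where `P₀ = K`). -/
def triSet (K : Type*) [Field K] (n : ℕ) :
    Set (Derivation K (MvPolynomial (Fin n) K) (MvPolynomial (Fin n) K)) :=
  {D | ∀ i : Fin n, D (X i) ∈ supported K {j : Fin n | (j : ℕ) < (i : ℕ)}}

theorem supported_upward {K : Type*} [Field K] {n : ℕ}
    (p : MvPolynomial (Fin n) K) (s t : Set (Fin n)) (hst : s ⊆ t)
    (hp : p ∈ supported K s) : p ∈ supported K t :=
  supported_mono hst hp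

theorem triSet_stable {K : Type*} [Field K] {n : ℕ}
    {D : Derivation K (MvPolynomial (Fin n) K) (MvPolynomial (Fin n) K)}
    (hD : D ∈ triSet K n) (i : Fin n) :
    ∀ j ∈ {j' : Fin n | (j' : ℕ) < (i : ℕ)},
      D (X j) ∈ supported K {j' : Fin n | (j' : ℕ) < (i : ℕ)} := by
  intro j hj
  refine supported_upward _ {j' : Fin n | (j' : ℕ) < (j : ℕ)} _ ?_ (hD j)
  intro l hl
  have hl' : (l : ℕ) < (j : ℕ) := hl
  have hj' : (j : ℕ) < (i : ℕ) := hj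
  exact lt_trans hl' hj'

theorem triSet_lie {K : Type*} [Field K] {n : ℕ}
    {a b : Derivation K (MvPolynomial (Fin n) K) (MvPolynomial (Fin n) K)}
    (ha : a ∈ triSet K n) (hb : b ∈ triSet K n) : ⁅a, b⁆ ∈ triSet K n := by
  intro i
  rw [Derivation.commutator_apply]
  exact sub_mem
    (Derivation.mem_supported_of_forall_mem _ a (triSet_stable ha i) (hb i))
    (Derivation.mem_supported_of_forall_mem _ b (triSet_stable hb i) (ha i))

/-- The Lie algebra `u_n = K∂₁ ⊕ P₁∂₂ ⊕ ⋯ ⊕ P_{n-1}∂ₙ` of triangular polynomial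
derivations, as a Lie subalgebra of the Lie algebra of all `K`-derivations of the
polynomial algebra `P_n = K[x₁,…,xₙ]`. -/
def triangular (K : Type*) [Field K] (n : ℕ) :
    LieSubalgebra K (Derivation K (MvPolynomial (Fin n) K) (MvPolynomial (Fin n) K)) where
  carrier := triSet K n
  add_mem' := fun {a b} ha hb i => by
    rw [Derivation.add_apply]; exact add_mem (ha i) (hb i)
  zero_mem' := fun i => by
    rw [Derivation.zero_apply]; exact zero_mem _
  smul_mem' := fun c a ha i => by
    rw [Derivation.smul_apply]; exact Subalgebra.smul_mem _ (ha i) c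
  lie_mem' := fun {a b} ha hb => triSet_lie ha hb

theorem mem_triangular_iff {K : Type*} [Field K] {n : ℕ}
    (D : Derivation K (MvPolynomial (Fin n) K) (MvPolynomial (Fin n) K)) :
    D ∈ triangular K n ↔
      ∀ i : Fin n, D (X i) ∈ supported K {j : Fin n | (j : ℕ) < (i : ℕ)} := Iff.rfl

/-- The partial derivative `∂ᵢ` as an element of the Lie algebra `u_n`. -/
def pd (K : Type*) [Field K] (n : ℕ) (i : Fin n) : ↥(triangular K n) :=
  ⟨pderiv i, by
    intro j
    rcases eq_or_ne j i with rfl | h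
    · rw [pderiv_X_self]
      exact one_mem _
    · rw [pderiv_X_of_ne h]
      exact zero_mem _⟩

/-- The element `x₁^i ∂ₙ` of the Lie algebra `u_n` (`x₁ = X ⟨0,_⟩`, `∂ₙ = pderiv ⟨n-1,_⟩`). -/
def mon (K : Type*) [Field K] (n : ℕ) (hn : 2 ≤ n) (i : ℕ) : ↥(triangular K n) :=
  ⟨(X (⟨0, by omega⟩ : Fin n)) ^ i • pderiv (⟨n - 1, by omega⟩ : Fin n), by
    intro j
    rw [Derivation.smul_apply, smul_eq_mul]
    rcases eq_or_ne j (⟨n - 1, by omega⟩ : Fin n) with rfl | h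
    · rw [pderiv_X_self, mul_one]
      refine pow_mem (X_mem_supported.mpr ?_) i
      show (0 : ℕ) < n - 1
      omega
    · rw [pderiv_X_of_ne h, mul_zero]
      exact zero_mem _⟩

section helpers

variable {K : Type*} [Field K] {n : ℕ}

/-- The element `f ∂_i` of `u_n`, for `f ∈ P_{i-1}`. -/
def fpd (i : Fin n) (f : MvPolynomial (Fin n) K)
    (hf : f ∈ supported K {j : Fin n | (j : ℕ) < (i : ℕ)}) : ↥(triangular K n) :=
  ⟨f • pderiv i, by
    intro j
    rw [Derivation.smul_apply, smul_eq_mul]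
    rcases eq_or_ne j i with rfl | h
    · rw [pderiv_X_self, mul_one]
      exact hf
    · rw [pderiv_X_of_ne h, mul_zero]
      exact zero_mem _⟩

theorem tri_preserves (D : ↥(triangular K n)) (i : Fin n) {f : MvPolynomial (Fin n) K}
    (hf : f ∈ supported K {j : Fin n | (j : ℕ) < (i : ℕ)}) :
    D.1 f ∈ supported K {j : Fin n | (j : ℕ) < (i : ℕ)} :=
  Derivation.mem_supported_of_forall_mem _ D.1 (triSet_stable D.2 i) hf

theorem pderiv_last_zero (L : Fin n) (hL : (L : ℕ) = n - 1) (j : Fin n)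
    {f : MvPolynomial (Fin n) K}
    (hf : f ∈ supported K {k : Fin n | (k : ℕ) < (j : ℕ)}) : pderiv L f = 0 := by
  refine Derivation.eq_zero_of_forall_eq_zero _ _ ?_ hf
  intro k hk
  have hk' : (k : ℕ) < (j : ℕ) := hk
  refine pderiv_X_of_ne ?_
  rintro rfl
  omega

theorem lie_fpd_last (L : Fin n) (hL : (L : ℕ) = n - 1) (D : ↥(triangular K n))
    (f : MvPolynomial (Fin n) K)
    (hf : f ∈ supported K {j : Fin n | (j : ℕ) < (L : ℕ)}) :
    ⁅D, fpd L f hf⁆ = fpd L (D.1 f) (tri_preserves D L hf) := by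
  apply Subtype.ext
  rw [LieSubalgebra.coe_bracket]
  apply MvPolynomial.derivation_ext
  intro j
  have h0 : pderiv L (D.1 (X j)) = 0 := pderiv_last_zero L hL j (D.2 j)
  rw [Derivation.commutator_apply]
  simp only [fpd, Derivation.smul_apply, smul_eq_mul, h0, mul_zero, sub_zero]
  rcases eq_or_ne j L with rfl | h
  · simp
  · simp [pderiv_X_of_ne h]

theorem tri_eq_fpd (L : Fin n) (D : ↥(triangular K n)) (h : ∀ j, j ≠ L → D.1 (X j) = 0) :
    D = fpd L (D.1 (X L)) (D.2 L) := by
  apply Subtype.ext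
  apply MvPolynomial.derivation_ext
  intro j
  simp only [fpd, Derivation.smul_apply, smul_eq_mul]
  rcases eq_or_ne j L with rfl | h'
  · simp
  · simp [pderiv_X_of_ne h', h j h']

theorem notMem_vars_of_pderiv [CharZero K] {f : MvPolynomial (Fin n) K} {i : Fin n}
    (h : pderiv i f = 0) : i ∉ f.vars := by
  intro hi
  rw [mem_vars_iff_mem_support] at hi
  obtain ⟨m, hm, him⟩ := hi
  have h1 := coeff_pderiv (i := i) f (m - Finsupp.single i 1)
  have h2 : m - Finsupp.single i 1 + Finsupp.single i 1 = m := by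
    apply tsub_add_cancel_of_le
    rw [Finsupp.single_le_iff]
    exact Nat.one_le_iff_ne_zero.mpr (Finsupp.mem_support_iff.mp him)
  rw [h, coeff_zero, h2] at h1
  rw [mem_support_iff] at hm
  rcases mul_eq_zero.mp h1.symm with h3 | h3
  · exact hm h3
  · exact Nat.cast_add_one_ne_zero _ h3

theorem totalDegree_pderiv_lt {f : MvPolynomial (Fin n) K} {i : Fin n}
    (h : pderiv i f ≠ 0) : (pderiv i f).totalDegree < f.totalDegree := by
  obtain ⟨m, hm, hd⟩ := Finset.exists_mem_eq_sup _ (support_nonempty.mpr h)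
    (fun s : Fin n →₀ ℕ => s.sum fun _ e => e)
  have h1 : (m + Finsupp.single i 1) ∈ f.support := by
    rw [mem_support_iff] at hm ⊢
    rw [coeff_pderiv] at hm
    exact left_ne_zero_of_mul hm
  have h2 := le_totalDegree h1
  rw [Finsupp.sum_add_index' (fun _ => rfl) (fun _ _ _ => rfl),
    Finsupp.sum_single_index rfl] at h2
  have h3 : (pderiv i f).totalDegree = m.sum fun _ e => e := hd
  omega

theorem lie_mem_of_mem (I : LieIdeal K ↥(triangular K n)) (D E : ↥(triangular K n))
    (h : E ∈ I) : ⁅D, E⁆ ∈ I := lie_mem_right K _ I D E h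

theorem lie_mem_of_mem' (I : LieIdeal K ↥(triangular K n)) (D E : ↥(triangular K n))
    (h : D ∈ I) : ⁅D, E⁆ ∈ I := lie_mem_left K _ I D E h

theorem fpd_congr (L : Fin n) {f g : MvPolynomial (Fin n) K} (h : f = g) (hf) (hg) :
    fpd L f hf = fpd L g hg := by
  subst h; rfl

theorem pd_mem_aux [CharZero K] (L : Fin n) (hL : (L : ℕ) = n - 1)
    (I : LieIdeal K ↥(triangular K n)) (d : ℕ) :
    ∀ (f : MvPolynomial (Fin n) K) (hf : f ∈ supported K {j : Fin n | (j : ℕ) < (L : ℕ)}),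
      f.totalDegree ≤ d → f ≠ 0 → fpd L f hf ∈ I → pd K n L ∈ I := by
  induction d with
  | zero =>
    intro f hf hd h0 hI
    have hc : f = C (coeff 0 f) := totalDegree_eq_zero_iff_eq_C.mp (by omega)
    have hne : coeff 0 f ≠ 0 := by
      intro h
      rw [h, C_0] at hc
      exact h0 hc
    have : pd K n L = (coeff 0 f)⁻¹ • fpd L f hf := by
      apply Subtype.ext
      apply MvPolynomial.derivation_ext
      intro j
      show pderiv L (X j) = (coeff 0 f)⁻¹ • (f * pderiv L (X j))
      generalize coeff 0 f = c at hc hne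
      rw [hc, ← smul_eq_C_mul, smul_smul, inv_mul_cancel₀ hne, one_smul]
    rw [this]
    exact I.smul_mem _ hI
  | succ d ih =>
    intro f hf hd h0 hI
    by_cases hz : ∀ j, pderiv j f = 0
    · have hv : f.vars = ∅ := by
        apply Finset.eq_empty_of_forall_notMem
        intro j
        exact notMem_vars_of_pderiv (hz j)
      have h1 := mem_supported_vars f
      rw [hv, Finset.coe_empty, supported_empty, Algebra.mem_bot] at h1
      obtain ⟨c, hc⟩ := h1
      refine ih f hf ?_ h0 hI
      rw [← hc]
      exact (totalDegree_C c).le.trans (Nat.zero_le _)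
    · push Not at hz
      obtain ⟨j, hj⟩ := hz
      have h1 := totalDegree_pderiv_lt hj
      have h2 := lie_mem_of_mem I (pd K n j) _ hI
      rw [lie_fpd_last L hL] at h2
      exact ih (pderiv j f) _ (by omega) hj h2

theorem bracket_mem (L : Fin n) (hL : (L : ℕ) = n - 1)
    (I : LieIdeal K ↥(triangular K n)) (D : ↥(triangular K n)) (hD : D ∈ I)
    (f : MvPolynomial (Fin n) K) (hf : f ∈ supported K {j : Fin n | (j : ℕ) < (L : ℕ)}) :
    fpd L (D.1 f) (tri_preserves D L hf) ∈ I := by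
  rw [← lie_fpd_last L hL D f hf]
  exact lie_mem_of_mem' I _ _ hD

theorem pd_mem [CharZero K] (L : Fin n) (hL : (L : ℕ) = n - 1)
    (I : LieIdeal K ↥(triangular K n)) (hI : I ≠ ⊥) : pd K n L ∈ I := by
  obtain ⟨D, hD, hD0⟩ := Submodule.exists_mem_ne_zero_of_ne_bot
    (fun h => hI ((LieSubmodule.toSubmodule_eq_bot I).mp h))
  by_cases h : ∀ j, j ≠ L → D.1 (X j) = 0
  · have := tri_eq_fpd L D h
    refine pd_mem_aux L hL I _ (D.1 (X L)) (D.2 L) le_rfl ?_ (this ▸ hD)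
    intro h0
    apply hD0
    apply Subtype.ext
    apply MvPolynomial.derivation_ext
    intro j
    rcases eq_or_ne j L with rfl | h'
    · simpa using h0
    · simpa using h j h'
  · push Not at h
    obtain ⟨j, hj, hj0⟩ := h
    have hjL : (X j : MvPolynomial (Fin n) K) ∈ supported K {j : Fin n | (j : ℕ) < (L : ℕ)} := by
      rw [X_mem_supported]
      have : (j : ℕ) ≠ L := fun h => hj (Fin.ext h)
      show (j : ℕ) < L
      omega
    exact pd_mem_aux L hL I _ _ _ le_rfl hj0 (bracket_mem L hL I D hD _ hjL)

/-- coefficient of `∂_n` -/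
def lastCoeff (L : Fin n) : ↥(triangular K n) →ₗ[K] MvPolynomial (Fin n) K where
  toFun D := D.1 (X L)
  map_add' _ _ := rfl
  map_smul' _ _ := rfl

theorem lastCoeff_fpd (L : Fin n) (f : MvPolynomial (Fin n) K) (hf) :
    lastCoeff L (fpd L f hf) = f := by
  simp [lastCoeff, fpd]

theorem infinite_aux (W : Submodule K (MvPolynomial (Fin n) K)) [FiniteDimensional K W]
    (i : Fin n) (a : MvPolynomial (Fin n) K) (ha : a ≠ 0)
    (h : ∀ k : ℕ, X i ^ k * a ∈ W) : False := by
  let φ : Polynomial K →ₗ[K] MvPolynomial (Fin n) K :=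
    (LinearMap.mulRight K a) ∘ₗ (Polynomial.aeval (X i : MvPolynomial (Fin n) K)).toLinearMap
  have hφ : ∀ p, φ p ∈ W := by
    intro p
    induction p using Polynomial.induction_on' with
    | add p q hp hq => rw [map_add]; exact add_mem hp hq
    | monomial k c =>
      have : φ (Polynomial.monomial k c) = c • (X i ^ k * a) := by
        simp [φ, Polynomial.aeval_monomial, Algebra.smul_def, mul_assoc]
      rw [this]
      exact W.smul_mem _ (h k)
  have hinj : Function.Injective φ := by
    rw [← LinearMap.ker_eq_bot, LinearMap.ker_eq_bot']
    intro p hp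
    have : Polynomial.aeval (X i : MvPolynomial (Fin n) K) p * a = 0 := hp
    rcases mul_eq_zero.mp this with h1 | h1
    · exact (transcendental_iff.mp (MvPolynomial.transcendental_X K i)) p h1
    · exact absurd h1 ha
  have := Module.Finite.of_injective (φ.codRestrict W hφ) (by
    intro p q hpq
    exact hinj (congrArg Subtype.val hpq))
  exact Polynomial.not_finite this

theorem polyMap_aux (Z L : Fin n) (hZL : (Z : ℕ) < L) (p : Polynomial K) :
    Polynomial.aeval (X Z : MvPolynomial (Fin n) K) p ∈
      supported K {j : Fin n | (j : ℕ) < (L : ℕ)} := by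
  have h : Polynomial.aeval (X Z : MvPolynomial (Fin n) K) p ∈
      Algebra.adjoin K {(X Z : MvPolynomial (Fin n) K)} := by
    rw [Algebra.adjoin_singleton_eq_range_aeval]; exact ⟨p, rfl⟩
  refine Algebra.adjoin_le ?_ h
  rintro _ rfl
  exact X_mem_supported.mpr hZL

/-- `p ↦ p(x_1) ∂_n` -/
def polyMap (Z L : Fin n) (hZL : (Z : ℕ) < L) : Polynomial K →ₗ[K] ↥(triangular K n) where
  toFun p := fpd L (Polynomial.aeval (X Z) p) (polyMap_aux Z L hZL p)
  map_add' p q := by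
    apply Subtype.ext
    simp [fpd, add_smul]
  map_smul' c p := by
    apply Subtype.ext
    simp [fpd]

theorem polyMap_injective (Z L : Fin n) (hZL : (Z : ℕ) < L) :
    Function.Injective (polyMap (K := K) Z L hZL) := by
  rw [← LinearMap.ker_eq_bot, LinearMap.ker_eq_bot']
  intro p hp
  have h := congrArg (lastCoeff L) hp
  have h1 : Polynomial.aeval (X Z : MvPolynomial (Fin n) K) p = 0 := by
    simpa [polyMap, lastCoeff_fpd] using h
  exact (transcendental_iff.mp (MvPolynomial.transcendental_X K Z)) p h1

theorem mem_range_polyMap [CharZero K] (Z L : Fin n) (hZ : (Z : ℕ) = 0) (hL : (L : ℕ) = n - 1)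
    (hZL : (Z : ℕ) < L) (I : LieIdeal K ↥(triangular K n)) [FiniteDimensional K ↥I]
    (D : ↥(triangular K n)) (hD : D ∈ I) : ∃ p, polyMap Z L hZL p = D := by
  let W : Submodule K (MvPolynomial (Fin n) K) := I.toSubmodule.map (lastCoeff L)
  have : FiniteDimensional K I.toSubmodule := inferInstanceAs (FiniteDimensional K ↥I)
  have : FiniteDimensional K W := inferInstanceAs (FiniteDimensional K (I.toSubmodule.map _))
  have hW : ∀ f hf, fpd L f hf ∈ I → f ∈ W := fun f hf h =>
    ⟨fpd L f hf, h, lastCoeff_fpd L f hf⟩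
  have h1 : ∀ j, j ≠ L → D.1 (X j) = 0 := by
    intro j hj
    by_contra hne
    have hjL : (X j : MvPolynomial (Fin n) K) ∈ supported K {j : Fin n | (j : ℕ) < (L : ℕ)} := by
      rw [X_mem_supported]
      have : (j : ℕ) ≠ L := fun h => hj (Fin.ext h)
      show (j : ℕ) < L
      omega
    refine infinite_aux W j (D.1 (X j)) hne ?_
    intro k
    have h2 := hW _ _ (bracket_mem L hL I D hD _ (pow_mem hjL (k + 1)))
    rw [Derivation.leibniz_pow, Nat.add_sub_cancel, smul_eq_mul] at h2
    have h3 := W.smul_mem ((k + 1 : ℕ) : K)⁻¹ h2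
    have h4 : ((k + 1 : ℕ) : K) ≠ 0 := Nat.cast_ne_zero.mpr (by omega)
    rw [← Nat.cast_smul_eq_nsmul K, smul_smul, inv_mul_cancel₀ h4, one_smul] at h3
    exact h3
  have hDe := tri_eq_fpd L D h1
  set f := D.1 (X L) with hf
  have hfs : f ∈ supported K {j : Fin n | (j : ℕ) < (L : ℕ)} := D.2 L
  have h2 : ∀ j, j ≠ Z → pderiv j f = 0 := by
    intro j hj
    by_contra hne
    refine infinite_aux W Z (pderiv j f) hne ?_
    intro k
    have hZj : (X Z : MvPolynomial (Fin n) K) ^ k ∈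
        supported K {l : Fin n | (l : ℕ) < (j : ℕ)} := by
      refine pow_mem (X_mem_supported.mpr ?_) k
      have : (j : ℕ) ≠ Z := fun h => hj (Fin.ext h)
      show (Z : ℕ) < j
      omega
    have h3 := lie_mem_of_mem I (fpd j (X Z ^ k) hZj) D hD
    rw [hDe, lie_fpd_last L hL] at h3
    exact hW _ _ h3
  have h3 : f ∈ supported K ({Z} : Set (Fin n)) := by
    rw [mem_supported]
    intro j hj
    by_contra hne
    exact notMem_vars_of_pderiv (h2 j hne) hj
  rw [supported_eq_adjoin_X, Set.image_singleton, Algebra.adjoin_singleton_eq_range_aeval] at h3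
  obtain ⟨p, hp⟩ := h3
  refine ⟨p, ?_⟩
  rw [hDe]
  exact fpd_congr L hp (polyMap_aux Z L hZL p) _

theorem degreeLT_le_of_mem [CharZero K] (V : Submodule K (Polynomial K))
    (hV : ∀ p ∈ V, Polynomial.derivative p ∈ V) (d : ℕ) :
    ∀ p ∈ V, p ≠ 0 → p.natDegree = d → Polynomial.degreeLT K (d + 1) ≤ V := by
  induction d with
  | zero =>
    intro p hp h0 hd q hq
    rw [Polynomial.mem_degreeLT] at hq
    have hp' := Polynomial.eq_C_of_natDegree_eq_zero hd
    have hq0 : q.degree ≤ 0 := by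
      rw [Polynomial.degree_lt_iff_coeff_zero] at hq
      rw [Polynomial.degree_le_iff_coeff_zero]
      intro m hm
      have : 0 < m := by exact_mod_cast hm
      exact hq m this
    have hq' := Polynomial.eq_C_of_degree_le_zero hq0
    have hc : p.coeff 0 ≠ 0 := by
      intro h
      rw [h, Polynomial.C_0] at hp'
      exact h0 hp'
    have : q = (q.coeff 0 * (p.coeff 0)⁻¹) • p := by
      rw [hp', hq']
      simp [Polynomial.smul_C, hc]
    rw [this]
    exact V.smul_mem _ hp
  | succ d ih =>
    intro p hp h0 hd q hq
    have hpd : p.derivative.natDegree = d := by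
      rw [Polynomial.natDegree_derivative, hd]; rfl
    have hpd0 : p.derivative ≠ 0 := by
      intro h
      have := Polynomial.derivative_eq_zero.mp h
      omega
    have h1 := ih _ (hV p hp) hpd0 hpd
    have hc : p.coeff (d + 1) ≠ 0 := by
      rw [← hd]; exact Polynomial.leadingCoeff_ne_zero.mpr h0
    have h2 : q - (q.coeff (d + 1) * (p.coeff (d + 1))⁻¹) • p ∈ V := by
      apply h1
      rw [Polynomial.mem_degreeLT, Polynomial.degree_lt_iff_coeff_zero]
      intro m hm
      rw [Polynomial.mem_degreeLT, Polynomial.degree_lt_iff_coeff_zero] at hq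
      rcases eq_or_lt_of_le hm with rfl | hm
      · simp [hc]
      · rw [Polynomial.coeff_sub, Polynomial.coeff_smul, hq m hm,
          Polynomial.coeff_eq_zero_of_natDegree_lt (p := p) (n := m) (by omega)]
        simp
    have := add_mem h2 (V.smul_mem (q.coeff (d + 1) * (p.coeff (d + 1))⁻¹) hp)
    simpa using this

theorem finrank_degLT (s : ℕ) : Module.finrank K (Polynomial.degreeLT K s) = s := by
  rw [(Polynomial.degreeLTEquiv K s).finrank_eq]; simp

theorem eq_degreeLT [CharZero K] (V : Submodule K (Polynomial K)) [FiniteDimensional K V]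
    (hV : ∀ p ∈ V, Polynomial.derivative p ∈ V) :
    V = Polynomial.degreeLT K (Module.finrank K V) := by
  have : FiniteDimensional K (Polynomial.degreeLT K (Module.finrank K V)) :=
    Module.Finite.equiv (Polynomial.degreeLTEquiv K _).symm
  apply Submodule.eq_of_le_of_finrank_eq
  · intro p hp
    rcases eq_or_ne p 0 with rfl | h0
    · exact zero_mem _
    have h1 := Submodule.finrank_mono (degreeLT_le_of_mem V hV _ p hp h0 rfl)
    rw [finrank_degLT] at h1
    rw [Polynomial.mem_degreeLT, Polynomial.degree_eq_natDegree h0]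
    exact_mod_cast h1
  · rw [finrank_degLT]

theorem map_degreeLT (hn : 2 ≤ n) (h : 0 < n - 1) (s : ℕ) :
    (Polynomial.degreeLT K s).map (polyMap (⟨0, by omega⟩ : Fin n) ⟨n - 1, by omega⟩ h) =
      Submodule.span K (mon K n hn '' Set.Iio s) := by
  classical
  rw [Polynomial.degreeLT_eq_span_X_pow, Submodule.map_span]
  congr 1
  ext D
  have key : ∀ k : ℕ, polyMap (⟨0, by omega⟩ : Fin n) ⟨n - 1, by omega⟩ h
      ((Polynomial.X : Polynomial K) ^ k) = mon K n hn k := by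
    intro k
    apply Subtype.ext
    simp [polyMap, fpd, mon]
  simp [key]

end helpers

/-- For `n ≥ 2`:
(1) the centre `K∂ₙ` is the least nonzero ideal of `u_n`: every nonzero ideal contains it;
(2) an ideal `I` of `u_n` is nonzero and finite dimensional over `K` iff
`I = ⊕_{i=0}^{s-1} K x₁^i ∂ₙ` for some `s ≥ 1`, in which case `dim_K I = s`. -/
theorem triangular_least_ideal_and_finite_dimensional_ideals
    (K : Type*) [Field K] [CharZero K] (n : ℕ) (hn : 2 ≤ n) :
    (∀ I : LieIdeal K ↥(triangular K n), I ≠ ⊥ →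
      Submodule.span K {pd K n ⟨n - 1, by omega⟩} ≤ I.toSubmodule) ∧
    (∀ I : LieIdeal K ↥(triangular K n),
      (I ≠ ⊥ ∧ FiniteDimensional K ↥I) ↔
        ∃ s : ℕ, 1 ≤ s ∧
          I.toSubmodule = Submodule.span K (mon K n hn '' Set.Iio s) ∧
          Module.finrank K ↥I = s) := by
  refine ⟨?_, ?_⟩
  · intro I hI
    rw [Submodule.span_singleton_le_iff_mem]
    exact pd_mem _ rfl I hI
  · intro I
    constructor
    · rintro ⟨hI, hfin⟩
      have hZL : ((⟨0, by omega⟩ : Fin n) : ℕ) < (⟨n - 1, by omega⟩ : Fin n) := by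
        show 0 < n - 1
        omega
      set φ := polyMap (K := K) (⟨0, by omega⟩ : Fin n) ⟨n - 1, by omega⟩ hZL with hφ
      have hinj : Function.Injective φ := polyMap_injective _ _ hZL
      let V : Submodule K (Polynomial K) := I.toSubmodule.comap φ
      have hmap : V.map φ = I.toSubmodule := by
        rw [Submodule.map_comap_eq_self]
        intro D hD
        exact mem_range_polyMap _ _ rfl rfl hZL I D hD
      let e : V ≃ₗ[K] (V.map φ) := Submodule.equivMapOfInjective φ hinj V
      have e' : V ≃ₗ[K] I.toSubmodule := e.trans (LinearEquiv.ofEq _ _ hmap)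
      have hfin' : FiniteDimensional K I.toSubmodule := hfin
      have hVfin : FiniteDimensional K V := Module.Finite.equiv e'.symm
      have hV : ∀ p ∈ V, Polynomial.derivative p ∈ V := by
        intro p hp
        have h1 := lie_mem_of_mem I (pd K n ⟨0, by omega⟩) _ (show φ p ∈ I from hp)
        have h2 : ⁅pd K n ⟨0, by omega⟩, φ p⁆ = φ (Polynomial.derivative p) := by
          refine (lie_fpd_last _ rfl _ _ (polyMap_aux _ _ hZL p)).trans ?_
          refine fpd_congr _ ?_ _ (polyMap_aux _ _ hZL _)
          show pderiv _ (Polynomial.aeval _ p) = _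
          rw [Derivation.map_aeval]
          simp
        rw [h2] at h1
        exact h1
      have hVe := eq_degreeLT V hV
      have hrank : Module.finrank K ↥I = Module.finrank K V := e'.finrank_eq.symm
      refine ⟨Module.finrank K V, ?_, ?_, hrank⟩
      · rw [Nat.one_le_iff_ne_zero, ← hrank]
        intro h0
        apply hI
        have h1 : I.toSubmodule = ⊥ := Submodule.finrank_eq_zero.mp h0
        exact (LieSubmodule.toSubmodule_eq_bot I).mp h1
      · rw [← map_degreeLT hn hZL, ← hVe, hmap]
    · rintro ⟨s, hs, hI, hr⟩
      refine ⟨?_, Module.finite_of_finrank_pos (by omega)⟩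
      rintro rfl
      have : Module.finrank K ↥(⊥ : LieIdeal K ↥(triangular K n)).toSubmodule = 0 := by
        rw [LieSubmodule.bot_toSubmodule]; exact finrank_bot _ _
      exact absurd (hr.symm.trans this) (by omega)
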